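/- (Hard-thresholding inner product bound, Lemma 1 of Liu–Foygel Barber) Let s* ≤ s ≤ M. For every v ∈ ℝ^M and every ω ∈ ℝ^M with at most s* nonzero entries, ⟨v − Φ_s(v), ω − Φ_s(v)⟩ ≤ (√(s*)/(2√s))·‖ω − Φ_s(v)‖₂². -/

import Mathlib

open MeasureTheory

noncomputable section

/-- The number of nonzero entries (the "ℓ₀ norm") of a vector. -/
def sparsity {M : ℕ} (u : Fin M → ℝ) : ℕ := Set.ncard {i | u i ≠ 0}

/-- `IsIsoProj v w x` means `x` is the isotonic regression of `w` with respect to the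
partial ordering induced by `v`, i.e. the Euclidean projection of `w` onto the closed
convex cone `C_v = {x | x i ≤ x j whenever v i ≤ v j}`. -/
def IsIsoProj {T : ℕ} (v w x : Fin T → ℝ) : Prop :=
  (∀ i j, v i ≤ v j → x i ≤ x j) ∧
  ∀ y : Fin T → ℝ, (∀ i j, v i ≤ v j → y i ≤ y j) →
    ∑ t, (w t - x t) ^ 2 ≤ ∑ t, (w t - y t) ^ 2

/-- `IsHardThresh s x y` means `y` is a hard-thresholding of `x` at sparsity level `s`:
`y` minimizes the Euclidean distance to `x` among all vectors with at most `s`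
nonzero entries (i.e. `y` keeps `s` largest-magnitude entries of `x`). -/
def IsHardThresh {M : ℕ} (s : ℕ) (x y : Fin M → ℝ) : Prop :=
  sparsity y ≤ s ∧ ∀ z : Fin M → ℝ, sparsity z ≤ s →
    ∑ i, (y i - x i) ^ 2 ≤ ∑ i, (z i - x i) ^ 2

lemma sparsity_eq_card {M : ℕ} (u : Fin M → ℝ) :
    sparsity u = (Finset.univ.filter fun i => u i ≠ 0).card := by
  rw [sparsity, Set.ncard_eq_toFinset_card']
  congr 1
  ext i
  simp

lemma sparsity_update_le {M : ℕ} (u : Fin M → ℝ) (i : Fin M) (a : ℝ) :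
    sparsity (Function.update u i a) ≤ sparsity u + 1 := by
  rw [sparsity_eq_card, sparsity_eq_card]
  refine (Finset.card_le_card (t := insert i (Finset.univ.filter fun k => u k ≠ 0)) ?_).trans
    (Finset.card_insert_le _ _)
  intro k hk
  by_cases h : k = i <;> simp_all

lemma sparsity_update_le_of_ne_zero {M : ℕ} (u : Fin M → ℝ) {i : Fin M} (hi : u i ≠ 0) (a : ℝ) :
    sparsity (Function.update u i a) ≤ sparsity u := by
  rw [sparsity_eq_card, sparsity_eq_card]
  refine Finset.card_le_card fun k hk => ?_
  by_cases h : k = i <;> simp_all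

lemma sparsity_update_zero_lt {M : ℕ} (u : Fin M → ℝ) {i : Fin M} (hi : u i ≠ 0) :
    sparsity (Function.update u i 0) < sparsity u := by
  rw [sparsity_eq_card, sparsity_eq_card]
  refine Finset.card_lt_card ((Finset.ssubset_iff_of_subset fun k hk => ?_).2 ⟨i, ?_, ?_⟩)
  · by_cases h : k = i <;> simp_all
  · simpa using hi
  · simp

lemma sum_sq_sub_update {M : ℕ} (u v : Fin M → ℝ) (i : Fin M) (a : ℝ) :
    ∑ k, (Function.update u i a k - v k) ^ 2 =
      ∑ k, (u k - v k) ^ 2 - (u i - v i) ^ 2 + (a - v i) ^ 2 := by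
  rw [← Finset.add_sum_erase _ _ (Finset.mem_univ i),
    ← Finset.add_sum_erase _ (fun k => (u k - v k) ^ 2) (Finset.mem_univ i)]
  have h : ∑ k ∈ Finset.univ.erase i, (Function.update u i a k - v k) ^ 2 =
      ∑ k ∈ Finset.univ.erase i, (u k - v k) ^ 2 :=
    Finset.sum_congr rfl fun k hk => by
      rw [Function.update_of_ne (Finset.ne_of_mem_erase hk)]
  rw [h, Function.update_self]
  ring

namespace IsHardThresh

variable {M s : ℕ} {v y : Fin M → ℝ}

lemma eq_of_sparsity_update_le (hy : IsHardThresh s v y) {i : Fin M}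
    (hi : sparsity (Function.update y i (v i)) ≤ s) : y i = v i := by
  have h := hy.2 _ hi
  rw [sum_sq_sub_update] at h
  nlinarith [sq_nonneg (y i - v i)]

lemma eq_of_ne_zero (hy : IsHardThresh s v y) {i : Fin M} (hi : y i ≠ 0) : y i = v i :=
  hy.eq_of_sparsity_update_le ((sparsity_update_le_of_ne_zero y hi _).trans hy.1)

lemma eq_of_sparsity_lt (hy : IsHardThresh s v y) (hs : sparsity y < s) : y = v :=
  funext fun i => hy.eq_of_sparsity_update_le ((sparsity_update_le y i _).trans hs)

lemma sq_le_sq (hy : IsHardThresh s v y) {i j : Fin M} (hi : y i ≠ 0) (hj : y j = 0) :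
    v j ^ 2 ≤ y i ^ 2 := by
  have hji : j ≠ i := by
    rintro rfl
    exact hi hj
  have h := hy.2 (Function.update (Function.update y i 0) j (v j))
    ((sparsity_update_le _ j _).trans ((sparsity_update_zero_lt y hi).trans_le hy.1))
  rw [sum_sq_sub_update, sum_sq_sub_update, Function.update_of_ne hji, hj,
    ← hy.eq_of_ne_zero hi] at h
  linarith

end IsHardThresh

/-- If every value of `f` on `T` is at most every value of `g` on `R`, then the average of `f` over
`T` is at most the average of `g` over `R`. -/
lemma card_mul_sum_le_card_mul_sum {ι : Type*} {T R : Finset ι} {f g : ι → ℝ}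
    (h : ∀ j ∈ T, ∀ i ∈ R, f j ≤ g i) :
    (R.card : ℝ) * ∑ j ∈ T, f j ≤ T.card * ∑ i ∈ R, g i := by
  calc (R.card : ℝ) * ∑ j ∈ T, f j = ∑ j ∈ T, ∑ _i ∈ R, f j := by
        simp [Finset.mul_sum]
    _ ≤ ∑ _j ∈ T, ∑ i ∈ R, g i :=
        Finset.sum_le_sum fun j hj => Finset.sum_le_sum fun i hi => h j hj i hi
    _ = T.card * ∑ i ∈ R, g i := by simp

lemma IsHardThresh.mul_sum_sq_le {M s m : ℕ} {v w y : Fin M → ℝ} (hms : m ≤ s)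
    (hw : sparsity w ≤ m) (hy : IsHardThresh s v y) (hs : sparsity y = s) :
    (s : ℝ) * ∑ j with w j ≠ 0 ∧ y j = 0, v j ^ 2 ≤
      m * ∑ i with y i ≠ 0 ∧ w i = 0, y i ^ 2 := by
  set T := Finset.univ.filter fun j => w j ≠ 0 ∧ y j = 0 with hT
  set R := Finset.univ.filter fun i => y i ≠ 0 ∧ w i = 0 with hR
  have hcount := card_mul_sum_le_card_mul_sum (T := T) (R := R) (f := fun j => v j ^ 2)
    (g := fun i => y i ^ 2) fun j hj i hi => by
      simp only [hT, hR, Finset.mem_filter] at hi hj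
      exact hy.sq_le_sq hi.2.1 hj.2.2
  rw [sparsity_eq_card] at hw hs
  have hTk : T.card + (Finset.univ.filter fun i => w i ≠ 0 ∧ y i ≠ 0).card ≤ m := by
    have := Finset.card_filter_add_card_filter_not (s := Finset.univ.filter fun i => w i ≠ 0)
      (fun i => y i = 0)
    simp only [Finset.filter_filter] at this
    exact this.trans_le hw
  have hRk : R.card + (Finset.univ.filter fun i => w i ≠ 0 ∧ y i ≠ 0).card = s := by
    have := Finset.card_filter_add_card_filter_not (s := Finset.univ.filter fun i => y i ≠ 0)
      (fun i => w i = 0)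
    simp only [Finset.filter_filter] at this
    rw [← hs, ← this]
    simp only [and_comm, ne_eq, hR]
  have hcard : s * T.card ≤ m * R.card := by
    nlinarith
  rcases Nat.eq_zero_or_pos R.card with h0 | hpos
  · rcases Nat.eq_zero_or_pos s with rfl | hspos
    · simp only [Nat.cast_zero, zero_mul]
      positivity
    · have hT0 : T = ∅ := by
        rw [← Finset.card_eq_zero]
        by_contra hne
        have := Nat.mul_pos hspos (Nat.pos_of_ne_zero hne)
        simp only [h0, mul_zero] at hcard
        omega
      rw [hT0, Finset.sum_empty, mul_zero]
      positivity
  · have hpos' : (0 : ℝ) < R.card := by exact_mod_cast hpos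
    have hcard' : (s : ℝ) * T.card ≤ m * R.card := by exact_mod_cast hcard
    refine le_of_mul_le_mul_left ?_ hpos'
    calc (R.card : ℝ) * (s * ∑ j ∈ T, v j ^ 2) = s * (R.card * ∑ j ∈ T, v j ^ 2) := by ring
      _ ≤ s * (T.card * ∑ i ∈ R, y i ^ 2) := by gcongr
      _ = s * T.card * ∑ i ∈ R, y i ^ 2 := by ring
      _ ≤ m * R.card * ∑ i ∈ R, y i ^ 2 := by gcongr
      _ = R.card * (m * ∑ i ∈ R, y i ^ 2) := by ring

/-- (Hard-thresholding inner product bound, Lemma 1 of Liu–Foygel Barber)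
Let s* ≤ s ≤ M.  For every v ∈ ℝ^M and every ω ∈ ℝ^M with at most s* nonzero entries,
⟨v − Φ_s(v), ω − Φ_s(v)⟩ ≤ (√(s*)/(2√s))·‖ω − Φ_s(v)‖₂². -/
theorem hard_thresh_inner_bound {M s sstar : ℕ} (hss : sstar ≤ s) (hsM : s ≤ M)
    (v w y : Fin M → ℝ)
    (hw : sparsity w ≤ sstar)
    (hy : IsHardThresh s v y) :
    ∑ i, (v i - y i) * (w i - y i) ≤
      (Real.sqrt (sstar : ℝ) / (2 * Real.sqrt (s : ℝ))) * ∑ i, (w i - y i) ^ 2 := by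
  set T := Finset.univ.filter fun j => w j ≠ 0 ∧ y j = 0 with hT
  set R := Finset.univ.filter fun i => y i ≠ 0 ∧ w i = 0 with hR
  have hinner : ∑ i, (v i - y i) * (w i - y i) = ∑ j ∈ T, v j * w j := by
    rw [hT, Finset.sum_filter]
    refine Finset.sum_congr rfl fun i _ => ?_
    by_cases hyi : y i = 0
    · by_cases hwi : w i = 0 <;> simp [hyi, hwi]
    · simp [hyi, ← hy.eq_of_ne_zero hyi]
  rcases hy.1.lt_or_eq with hlt | hs
  · rw [hy.eq_of_sparsity_lt hlt]
    simp only [sub_self, zero_mul, Finset.sum_const_zero]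
    positivity
  rcases Nat.eq_zero_or_pos sstar with rfl | hpos
  · have hT0 : T = ∅ := by
      rw [sparsity_eq_card, Nat.le_zero, Finset.card_eq_zero] at hw
      rw [hT, ← Finset.filter_filter, hw, Finset.filter_empty]
    simp [hinner, hT0]
  have hsq := hy.mul_sum_sq_le hss hw hs
  have hsplit : ∑ j ∈ T, w j ^ 2 + ∑ i ∈ R, y i ^ 2 ≤ ∑ i, (w i - y i) ^ 2 := by
    rw [hT, hR, Finset.sum_filter, Finset.sum_filter, ← Finset.sum_add_distrib]
    refine Finset.sum_le_sum fun i _ => ?_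
    by_cases hyi : y i = 0 <;> by_cases hwi : w i = 0 <;> simp [hyi, hwi, sq_nonneg]
  have hb : 0 < √(s : ℝ) := Real.sqrt_pos.2 (by exact_mod_cast hpos.trans_le hss)
  have ha : 0 < √(sstar : ℝ) := Real.sqrt_pos.2 (by exact_mod_cast hpos)
  have hb2 : √(s : ℝ) ^ 2 = s := Real.sq_sqrt (Nat.cast_nonneg _)
  have ha2 : √(sstar : ℝ) ^ 2 = sstar := Real.sq_sqrt (Nat.cast_nonneg _)
  rw [← hb2, ← ha2] at hsq
  set a := √(sstar : ℝ)
  set b := √(s : ℝ)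
  have hyoung : 2 * a * b * ∑ j ∈ T, v j * w j ≤
      a ^ 2 * ∑ j ∈ T, w j ^ 2 + b ^ 2 * ∑ j ∈ T, v j ^ 2 := by
    simp only [Finset.mul_sum, ← Finset.sum_add_distrib]
    exact Finset.sum_le_sum fun j _ => by nlinarith [sq_nonneg (a * w j - b * v j)]
  have hmul : a ^ 2 * (∑ j ∈ T, w j ^ 2 + ∑ i ∈ R, y i ^ 2) ≤ a ^ 2 * ∑ i, (w i - y i) ^ 2 := by
    gcongr
  rw [hinner, div_mul_eq_mul_div, le_div_iff₀ (by positivity)]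
  refine le_of_mul_le_mul_left ?_ ha
  linarith
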